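/- Let L be a domain and let E be a separable metrizable topological space. Every L-valued optimal measure on the Borel σ-algebra ℬ of E is regular. -/

import Mathlib

open Set

universe u v

section OrderDefs
variable {L : Type u} [PartialOrder L]

/-- A filtered (nonempty, downward directed) subset of a poset. -/
def DirFiltered (F : Set L) : Prop :=
  F.Nonempty ∧ ∀ r ∈ F, ∀ s ∈ F, ∃ t ∈ F, t ≤ r ∧ t ≤ s

/-- A filter of a poset: a filtered upper set. -/
def OrdFilter (F : Set L) : Prop :=
  DirFiltered F ∧ ∀ r ∈ F, ∀ s : L, r ≤ s → s ∈ F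

/-- Every filter has an infimum. -/
def FilteredComplete (L : Type u) [PartialOrder L] : Prop :=
  ∀ F : Set L, OrdFilter F → ∃ i : L, IsGLB F i

/-- `s` is way-above `r`: for every filter `F` with an infimum below `r`, `s ∈ F`. -/
def WayAbove (s r : L) : Prop :=
  ∀ F : Set L, OrdFilter F → ∀ i : L, IsGLB F i → i ≤ r → s ∈ F

/-- The poset is continuous: for every `r`, the set of elements way-above `r`
is a filter whose infimum is `r`. -/
def ContinuousPoset (L : Type u) [PartialOrder L] : Prop :=
  ∀ r : L, OrdFilter {s : L | WayAbove s r} ∧ IsGLB {s : L | WayAbove s r} r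

/-- Conditional completeness: every nonempty set bounded above has a supremum. -/
def CondComplete (L : Type u) [PartialOrder L] : Prop :=
  ∀ S : Set L, S.Nonempty → BddAbove S → ∃ m : L, IsLUB S m

end OrderDefs

/-- A domain: a filtered-complete continuous poset with a least element. -/
def DomainPoset (L : Type u) [PartialOrder L] [OrderBot L] : Prop :=
  FilteredComplete L ∧ ContinuousPoset L

section TopDefs
variable {E : Type v} [TopologicalSpace E]

/-- The saturation of a set: intersection of all open sets containing it. -/
def satur (A : Set E) : Set E := ⋂₀ {G : Set E | IsOpen G ∧ A ⊆ G}

/-- A set is saturated if it is an intersection of open sets. -/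
def IsSatur (A : Set E) : Prop :=
  ∃ 𝒢 : Set (Set E), (∀ G ∈ 𝒢, IsOpen G) ∧ A = ⋂₀ 𝒢

/-- The collection 𝒬 of compact saturated subsets. -/
def CompactSat (E : Type v) [TopologicalSpace E] : Set (Set E) :=
  {A : Set E | IsCompact A ∧ IsSatur A}

/-- The Borel σ-algebra generated by open sets and compact saturated sets. -/
def BorelM (E : Type v) [TopologicalSpace E] : MeasurableSpace E :=
  MeasurableSpace.generateFrom ({A : Set E | IsOpen A} ∪ CompactSat E)

/-- Borel subsets for the σ-algebra generated by opens and compact saturated sets. -/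
def IsBorelSet (B : Set E) : Prop := @MeasurableSet E (BorelM E) B

/-- The collection 𝒦 of compact Borel subsets. -/
def CompactBorel (E : Type v) [TopologicalSpace E] : Set (Set E) :=
  {A : Set E | IsBorelSet A ∧ IsCompact A}

/-- `[x]` : the compact Borel set `↑{x} ∩ closure {x}`. -/
def ptClass (x : E) : Set E := satur {x} ∩ closure {x}

end TopDefs

section MeasDefs
variable {L : Type u} {E : Type v} [PartialOrder L] [OrderBot L] [TopologicalSpace E]

/-- An L-valued maxitive measure on the Borel σ-algebra. -/
def Maxitive (ν : Set E → L) : Prop :=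
  ν ∅ = ⊥ ∧ ∀ 𝒞 : Set (Set E), 𝒞.Finite → (∀ B ∈ 𝒞, IsBorelSet B) →
    IsLUB (ν '' 𝒞) (ν (⋃₀ 𝒞))

/-- σ-maxitivity. -/
def SigmaMaxitive (ν : Set E → L) : Prop :=
  Maxitive ν ∧ ∀ 𝒞 : Set (Set E), 𝒞.Countable → (∀ B ∈ 𝒞, IsBorelSet B) →
    IsLUB (ν '' 𝒞) (ν (⋃₀ 𝒞))

/-- Complete maxitivity. -/
def CompletelyMaxitive (ν : Set E → L) : Prop :=
  Maxitive ν ∧ ∀ 𝒞 : Set (Set E), (∀ B ∈ 𝒞, IsBorelSet B) → IsBorelSet (⋃₀ 𝒞) →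
    IsLUB (ν '' 𝒞) (ν (⋃₀ 𝒞))

/-- The set `{ν G : G open, G ⊇ B}`. -/
def outerVals (ν : Set E → L) (B : Set E) : Set L :=
  {l : L | ∃ G : Set E, IsOpen G ∧ B ⊆ G ∧ ν G = l}

/-- `νp` is the map `ν⁺ : B ↦ inf {ν G : G open, G ⊇ B}` on Borel sets. -/
def IsNuPlus (ν νp : Set E → L) : Prop :=
  ∀ B : Set E, IsBorelSet B → IsGLB (outerVals ν B) (νp B)

/-- Outer-continuity. -/
def OuterContinuous (ν : Set E → L) : Prop :=
  ∀ B : Set E, IsBorelSet B → IsGLB (outerVals ν B) (ν B)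

/-- Inner-continuity. -/
def InnerContinuous (ν : Set E → L) : Prop :=
  ∀ B : Set E, IsBorelSet B →
    IsLUB {l : L | ∃ K : Set E, IsBorelSet K ∧ IsCompact K ∧ K ⊆ B ∧ ν (satur K) = l} (ν B)

/-- Regularity: inner- and outer-continuity. -/
def RegularMeasure (ν : Set E → L) : Prop :=
  InnerContinuous ν ∧ OuterContinuous ν

/-- Weak outer-continuity: `ν K = ν⁺ K` for every compact Borel `K`. -/
def WeaklyOuterContinuous (ν : Set E → L) : Prop :=
  ∀ K : Set E, IsBorelSet K → IsCompact K → IsGLB (outerVals ν K) (ν K)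

/-- Weak inner-continuity (relative to a given `ν⁺ = νp`). -/
def WeaklyInnerContinuous (ν νp : Set E → L) : Prop :=
  ∀ G : Set E, IsOpen G →
    IsLUB {l : L | ∃ K : Set E, IsBorelSet K ∧ IsCompact K ∧ K ⊆ G ∧ νp K = l} (ν G)

/-- 𝒜-smoothness. -/
def SmoothWrt (ν : Set E → L) (𝒜 : Set (Set E)) : Prop :=
  ∀ 𝒟 : Set (Set E), 𝒟.Nonempty → 𝒟 ⊆ 𝒜 → DirectedOn (· ⊇ ·) 𝒟 →
    IsGLB (ν '' 𝒟) (ν (⋂₀ 𝒟))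

/-- Saturation of a maxitive measure: `ν K = ν (↑K)` for compact Borel `K`. -/
def SaturatedMeasure (ν : Set E → L) : Prop :=
  ∀ K : Set E, IsBorelSet K → IsCompact K → ν K = ν (satur K)

/-- Tightness: `inf {ν (E ∖ K) : K compact Borel} = 0`. -/
def TightMeasure (ν : Set E → L) : Prop :=
  IsGLB {l : L | ∃ K : Set E, IsBorelSet K ∧ IsCompact K ∧ ν Kᶜ = l} (⊥ : L)

/-- `c` is a cardinal density of `ν`. -/
def IsCardinalDensity (ν : Set E → L) (c : E → L) : Prop :=
  ∀ B : Set E, IsBorelSet B → IsLUB (c '' B) (ν B)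

/-- Upper semicontinuity of a map into the poset. -/
def UscMap (c : E → L) : Prop := ∀ t : L, IsOpen {x : E | WayAbove t (c x)}

/-- Upper compactness of a map into the poset. -/
def UpperCompactMap (c : E → L) : Prop :=
  ∀ t : L, WayAbove t (⊥ : L) → IsCompact {x : E | ¬ WayAbove t (c x)}

/-- Continuity from above along decreasing sequences of Borel sets. -/
def ContinuousFromAbove (ν : Set E → L) : Prop :=
  ∀ B : ℕ → Set E, (∀ n, IsBorelSet (B n)) → (∀ n, B (n + 1) ⊆ B n) →
    IsGLB (Set.range fun n => ν (B n)) (ν (⋂ n, B n))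

/-- An optimal measure: a σ-maxitive measure continuous from above. -/
def OptimalMeasure (ν : Set E → L) : Prop :=
  SigmaMaxitive ν ∧ ContinuousFromAbove ν

/-- `flo` is the regular part `⌊ν⌋` (relative to `νp = ν⁺`):
`⌊ν⌋(B) = sup {ν⁺(K) : K compact Borel, K ⊆ B}`. -/
def RegPartRel (νp flo : Set E → L) : Prop :=
  ∀ B : Set E, IsBorelSet B →
    IsLUB {l : L | ∃ K : Set E, IsBorelSet K ∧ IsCompact K ∧ K ⊆ B ∧ νp K = l} (flo B)

end MeasDefs

section Helpers
variable {L : Type u} {E : Type v} [PartialOrder L]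

theorem IsOpen.isBorelSet [TopologicalSpace E] {G : Set E} (hG : IsOpen G) : IsBorelSet G :=
  MeasurableSpace.measurableSet_generateFrom (Or.inl hG)

theorem IsClosed.isBorelSet [TopologicalSpace E] {F : Set E} (hF : IsClosed F) :
    IsBorelSet F := by
  have h : IsBorelSet Fᶜ := hF.isOpen_compl.isBorelSet
  exact (@MeasurableSet.compl_iff E F (BorelM E)).1 h

/-- In a T1 space, every set is equal to its saturation. -/
theorem satur_eq [TopologicalSpace E] [T1Space E] (A : Set E) : satur A = A := by
  refine Subset.antisymm (fun y hy => ?_) (subset_sInter fun G hG => hG.2)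
  by_contra hyA
  exact hy {y}ᶜ ⟨isOpen_compl_singleton, fun z hz hzy => hyA (hzy ▸ hz)⟩ rfl

/-- If the infimum of a decreasing sequence is below `r`, every element way-above `r` dominates
some term of the sequence. -/
theorem WayAbove.exists_le_of_antitone {s r i : L} (h : WayAbove s r) {f : ℕ → L}
    (hf : Antitone f) (hi : IsGLB (range f) i) (hir : i ≤ r) : ∃ n, f n ≤ s := by
  refine h {l | ∃ n, f n ≤ l} ⟨⟨⟨f 0, 0, le_rfl⟩, ?_⟩, ?_⟩ i ⟨?_, ?_⟩ hir
  · rintro a ⟨m, hm⟩ b ⟨n, hn⟩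
    exact ⟨f (max m n), ⟨_, le_rfl⟩, (hf (le_max_left m n)).trans hm,
      (hf (le_max_right m n)).trans hn⟩
  · rintro a ⟨m, hm⟩ b hab
    exact ⟨m, hm.trans hab⟩
  · rintro a ⟨m, hm⟩
    exact (hi.1 ⟨m, rfl⟩).trans hm
  · intro b hb
    refine hi.2 ?_
    rintro _ ⟨n, rfl⟩
    exact hb ⟨n, le_rfl⟩

variable [OrderBot L] {ν : Set E → L}

theorem Maxitive.mono [TopologicalSpace E] (hν : Maxitive ν) {A B : Set E} (hA : IsBorelSet A)
    (hB : IsBorelSet B) (hAB : A ⊆ B) : ν A ≤ ν B := by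
  have h := hν.2 {A, B} (by simp) (by rintro C (rfl | rfl) <;> assumption)
  rw [sUnion_pair, union_eq_self_of_subset_left hAB] at h
  exact h.1 ⟨A, by simp, rfl⟩

/-- An optimal measure takes small values on small neighbourhoods of a point. -/
theorem OptimalMeasure.exists_isOpen_mem_le [TopologicalSpace E]
    [TopologicalSpace.MetrizableSpace E] (hν : OptimalMeasure ν) {x : E} {s r : L}
    (hx : ν {x} ≤ r) (hs : WayAbove s r) : ∃ G : Set E, IsOpen G ∧ x ∈ G ∧ ν G ≤ s := by
  let := TopologicalSpace.metrizableSpaceMetric E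
  let U : ℕ → Set E := fun n => Metric.ball x (1 / ((n : ℝ) + 1))
  have hU : ∀ n, IsBorelSet (U n) := fun n => Metric.isOpen_ball.isBorelSet
  have hanti : Antitone U := fun m n hmn =>
    Metric.ball_subset_ball (one_div_le_one_div_of_le (by positivity) (by gcongr))
  have hinter : ⋂ n, U n = {x} := by
    refine Subset.antisymm (fun y hy => ?_) ?_
    · by_contra hyx
      obtain ⟨n, hn⟩ := exists_nat_one_div_lt (dist_pos.2 hyx)
      exact lt_asymm hn (Metric.mem_ball.1 (mem_iInter.1 hy n))
    · rintro _ rfl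
      exact mem_iInter.2 fun n => Metric.mem_ball_self (by positivity)
  have hglb := hν.2 U hU fun n => hanti n.le_succ
  rw [hinter] at hglb
  obtain ⟨n, hn⟩ := hs.exists_le_of_antitone
    (fun m n hmn => hν.1.1.mono (hU n) (hU m) (hanti hmn)) hglb hx
  exact ⟨U n, Metric.isOpen_ball, Metric.mem_ball_self (by positivity), hn⟩

/-- If an optimal measure is bounded by `r` on the points of `B`, then it is bounded on an open
neighbourhood of `B` by any given element way-above `r`. -/
theorem OptimalMeasure.exists_isOpen_superset_le [TopologicalSpace E]
    [TopologicalSpace.MetrizableSpace E] [TopologicalSpace.SeparableSpace E]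
    (hν : OptimalMeasure ν) {B : Set E} {s r : L} (hB : ∀ x ∈ B, ν {x} ≤ r)
    (hs : WayAbove s r) : ∃ G : Set E, IsOpen G ∧ B ⊆ G ∧ ν G ≤ s := by
  let := TopologicalSpace.metrizableSpaceMetric E
  have := UniformSpace.secondCountable_of_separable E
  obtain ⟨T, hTc, hTS, hT⟩ := TopologicalSpace.isOpen_sUnion_countable
    {G : Set E | IsOpen G ∧ ν G ≤ s} fun G hG => hG.1
  refine ⟨⋃₀ T, isOpen_sUnion fun G hG => (hTS hG).1, fun x hx => ?_, ?_⟩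
  · obtain ⟨G, hGo, hxG, hGs⟩ := hν.exists_isOpen_mem_le (hB x hx) hs
    rw [hT]
    exact ⟨G, ⟨hGo, hGs⟩, hxG⟩
  · refine (hν.1.2 T hTc fun G hG => (hTS hG).1.isBorelSet).2 ?_
    rintro _ ⟨G, hG, rfl⟩
    exact (hTS hG).2

end Helpers

/-- on a separable metrizable space, every optimal measure is regular. -/
theorem stmt19 {L : Type u} {E : Type v} [PartialOrder L] [OrderBot L]
    [TopologicalSpace E] [TopologicalSpace.MetrizableSpace E]
    [TopologicalSpace.SeparableSpace E] (hL : DomainPoset L)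
    (ν : Set E → L) (hν : OptimalMeasure ν) :
    RegularMeasure ν := by
  have mono {A B : Set E} (hA : IsBorelSet A) (hB : IsBorelSet B) (hAB : A ⊆ B) : ν A ≤ ν B :=
    hν.1.1.mono hA hB hAB
  refine ⟨fun B hB => ⟨?_, fun u hu => ?_⟩, fun B hB => ⟨?_, fun l hl => ?_⟩⟩
  · rintro _ ⟨K, hK, -, hKB, rfl⟩
    rw [satur_eq]
    exact mono hK hB hKB
  · have hpt : ∀ x ∈ B, ν {x} ≤ u := fun x hx =>
      hu ⟨{x}, isClosed_singleton.isBorelSet, isCompact_singleton, singleton_subset_iff.2 hx,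
        by rw [satur_eq]⟩
    refine (hL.2 u).2.2 fun s hs => ?_
    obtain ⟨G, hGo, hBG, hGs⟩ := hν.exists_isOpen_superset_le hpt hs
    exact (mono hB hGo.isBorelSet hBG).trans hGs
  · rintro _ ⟨G, hGo, hBG, rfl⟩
    exact mono hB hGo.isBorelSet hBG
  · have hpt : ∀ x ∈ B, ν {x} ≤ ν B := fun x hx =>
      mono isClosed_singleton.isBorelSet hB (singleton_subset_iff.2 hx)
    refine (hL.2 (ν B)).2.2 fun s hs => ?_
    obtain ⟨G, hGo, hBG, hGs⟩ := hν.exists_isOpen_superset_le hpt hs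
    exact (hl ⟨G, hGo, hBG, rfl⟩).trans hGs
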